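/- Let Γ be an infinite group generated by a finite generating family S = (s_1, …, s_d) and let G = Cay(Γ, S). Then ι_E(G) ≥ d·(1 − ρ(G)). -/

import Mathlib

open MeasureTheory Set

noncomputable section

variable {Γ : Type} [Group Γ] {d : ℕ}

/-- The edge `(g, i)` of the Cayley graph `Cay(Γ, S)` joins `g` and `g * S i`. -/
def Joins (S : Fin d → Γ) (e : Γ × Fin d) (u v : Γ) : Prop :=
  (u = e.1 ∧ v = e.1 * S e.2) ∨ (v = e.1 ∧ u = e.1 * S e.2)

/-- The set of edges of `Cay(Γ, S)` with exactly one endpoint in `F`. -/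
def edgeBoundary (S : Fin d → Γ) (F : Finset Γ) : Set (Γ × Fin d) :=
  {e | Xor' (e.1 ∈ F) (e.1 * S e.2 ∈ F)}

/-- The edge-isoperimetric constant `ι_E(Cay(Γ, S))`. -/
def iotaE (S : Fin d → Γ) : ℝ :=
  sInf {r | ∃ F : Finset Γ, F.Nonempty ∧ r = ((edgeBoundary S F).ncard : ℝ) / (F.card : ℝ)}

/-- The `ℓ²`-norm of a function `f : Γ → ℝ` (junk value if not square-summable). -/
def l2norm (f : Γ → ℝ) : ℝ := Real.sqrt (∑' g, f g ^ 2)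

/-- The simple random walk operator: `(P f)(g) = (1/d) ∑ i, f (g * S i)`. -/
def rwOp (S : Fin d → Γ) (f : Γ → ℝ) : Γ → ℝ := fun g => (∑ i, f (g * S i)) / d

/-- The spectral radius `ρ(Cay(Γ, S))`, i.e. the operator norm of the simple random walk
operator on `ℓ²(Γ)`: the least constant `c ≥ 0` with `‖P f‖₂ ≤ c ‖f‖₂` (by density it
suffices to test finitely supported functions). -/
def specRad (S : Fin d → Γ) : ℝ :=
  sInf {c | 0 ≤ c ∧ ∀ f : Γ →₀ ℝ, l2norm (rwOp S ⇑f) ≤ c * l2norm ⇑f}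

lemma rwOp_sq_le (S : Fin d → Γ) (f : Γ → ℝ) (g : Γ) :
    rwOp S f g ^ 2 ≤ (∑ i, f (g * S i) ^ 2) / d := by
  rcases eq_or_ne d 0 with rfl | hd
  · simp [rwOp]
  have hd' : (0 : ℝ) < d := by positivity
  have h := sq_sum_le_card_mul_sum_sq (s := Finset.univ) (f := fun i => f (g * S i))
  rw [Finset.card_univ, Fintype.card_fin] at h
  rw [rwOp, div_pow, div_le_div_iff₀ (by positivity) hd']
  nlinarith

lemma summable_sq_mul_right {f : Γ → ℝ} (hf : Summable fun g => f g ^ 2) (s : Γ) :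
    Summable fun g => f (g * s) ^ 2 :=
  (Equiv.mulRight s).summable_iff.mpr hf

lemma summable_sum_sq_mul_right (S : Fin d → Γ) {f : Γ → ℝ} (hf : Summable fun g => f g ^ 2) :
    Summable fun g => (∑ i, f (g * S i) ^ 2) / d :=
  (summable_sum fun i _ => summable_sq_mul_right hf (S i)).div_const _

lemma summable_rwOp_sq (S : Fin d → Γ) {f : Γ → ℝ} (hf : Summable fun g => f g ^ 2) :
    Summable fun g => rwOp S f g ^ 2 :=
  (summable_sum_sq_mul_right S hf).of_nonneg_of_le (fun _ => sq_nonneg _) (rwOp_sq_le S f)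

lemma l2norm_rwOp_le (S : Fin d → Γ) {f : Γ → ℝ} (hf : Summable fun g => f g ^ 2) :
    l2norm (rwOp S f) ≤ l2norm f := by
  refine Real.sqrt_le_sqrt ?_
  calc ∑' g, rwOp S f g ^ 2
      ≤ ∑' g, (∑ i, f (g * S i) ^ 2) / d :=
        (summable_rwOp_sq S hf).tsum_le_tsum (rwOp_sq_le S f) (summable_sum_sq_mul_right S hf)
    _ = (∑ _i : Fin d, ∑' g, f g ^ 2) / d := by
        rw [tsum_div_const, Summable.tsum_finsetSum fun i _ => summable_sq_mul_right hf (S i)]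
        congr 1
        exact Finset.sum_congr rfl fun i _ =>
          (Equiv.mulRight (S i)).tsum_eq fun g => f g ^ 2
    _ ≤ ∑' g, f g ^ 2 := by
        have h : 0 ≤ ∑' g, f g ^ 2 := tsum_nonneg fun _ => sq_nonneg _
        rw [Finset.sum_const, Finset.card_univ, Fintype.card_fin, nsmul_eq_mul]
        exact div_le_of_le_mul₀ d.cast_nonneg h (mul_comm _ _).le

lemma summable_sq_finsupp {α : Type*} (f : α →₀ ℝ) : Summable fun g => f g ^ 2 :=
  summable_of_ne_finset_zero (s := f.support) fun g hg => by
    simp [Finsupp.notMem_support_iff.mp hg]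

lemma finite_edgeBoundary (S : Fin d → Γ) (F : Finset Γ) : (edgeBoundary S F).Finite := by
  have h : (edgeBoundary S F) ⊆ ((F : Set Γ) ×ˢ Set.univ) ∪
      (fun e : Γ × Fin d => (e.1 * (S e.2)⁻¹, e.2)) '' ((F : Set Γ) ×ˢ Set.univ) := by
    rintro ⟨g, i⟩ (⟨hg, -⟩ | ⟨hg, -⟩)
    · exact Or.inl ⟨hg, Set.mem_univ _⟩
    · exact Or.inr ⟨(g * S i, i), ⟨hg, Set.mem_univ _⟩, by simp⟩
  have hF := F.finite_toSet.prod (Set.finite_univ (α := Fin d))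
  exact (hF.union (hF.image _)).subset h

open Classical in
/-- Counting the edges that start in `F` according to whether they end in `F`. -/
lemma card_mul_le_ncard_edgeBoundary_add (S : Fin d → Γ) (F : Finset Γ) :
    (d : ℝ) * F.card ≤ (edgeBoundary S F).ncard +
      ∑ g ∈ F, ∑ i, if g * S i ∈ F then (1 : ℝ) else 0 := by
  have hsub : ((((F ×ˢ Finset.univ).filter fun e : Γ × Fin d => ¬ e.1 * S e.2 ∈ F) :
      Finset (Γ × Fin d)) : Set (Γ × Fin d)) ⊆ edgeBoundary S F := by
    intro e he
    simp only [Finset.coe_filter, Finset.mem_product, Finset.mem_univ, and_true,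
      Set.mem_ofPred_eq] at he
    exact Or.inl he
  have hle := Set.ncard_le_ncard hsub (finite_edgeBoundary S F)
  rw [Set.ncard_coe_finset] at hle
  have hcard := Finset.card_filter_add_card_filter_not (s := F ×ˢ (Finset.univ : Finset (Fin d)))
    (fun e : Γ × Fin d => e.1 * S e.2 ∈ F)
  rw [Finset.card_product, Finset.card_univ, Fintype.card_fin] at hcard
  rw [← Finset.sum_product' F Finset.univ fun g i => if g * S i ∈ F then (1 : ℝ) else 0,
    Finset.sum_boole]
  have : d * F.card ≤ (edgeBoundary S F).ncard +
      ((F ×ˢ Finset.univ).filter fun e : Γ × Fin d => e.1 * S e.2 ∈ F).card := by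
    rw [mul_comm]; omega
  exact_mod_cast this

open Classical in
/-- Cauchy–Schwarz against the indicator function of `F`. -/
lemma sum_rwOp_indicator_le (S : Fin d → Γ) (F : Finset Γ) {c : ℝ}
    (hc : ∀ f : Γ →₀ ℝ, l2norm (rwOp S ⇑f) ≤ c * l2norm ⇑f) :
    ∑ g ∈ F, rwOp S (fun x => if x ∈ F then (1 : ℝ) else 0) g ≤ c * F.card := by
  let f : Γ →₀ ℝ := Finsupp.onFinset F (fun x => if x ∈ F then (1 : ℝ) else 0) (by simp)
  have hfc : ⇑f = fun x => if x ∈ F then (1 : ℝ) else 0 := rfl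
  rw [← hfc]
  have hnorm : l2norm ⇑f = √(F.card : ℝ) := by
    rw [l2norm, tsum_eq_sum (s := F) fun g hg => by simp [hfc, hg]]
    congr 1
    simp +contextual [hfc]
  calc ∑ g ∈ F, rwOp S f g
      = ∑ g ∈ F, 1 * rwOp S f g := by simp
    _ ≤ √(∑ _g ∈ F, (1 : ℝ) ^ 2) * √(∑ g ∈ F, rwOp S f g ^ 2) :=
        Real.sum_mul_le_sqrt_mul_sqrt F _ _
    _ ≤ √(F.card : ℝ) * l2norm (rwOp S f) := by
        refine mul_le_mul (by simp) (Real.sqrt_le_sqrt ?_) (Real.sqrt_nonneg _) (Real.sqrt_nonneg _)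
        exact (summable_rwOp_sq S (summable_sq_finsupp f)).sum_le_tsum F fun _ _ => sq_nonneg _
    _ ≤ √(F.card : ℝ) * (c * √(F.card : ℝ)) := by
        rw [← hnorm]
        exact mul_le_mul_of_nonneg_left (hc f) (Real.sqrt_nonneg _)
    _ = c * F.card := by
        rw [mul_left_comm, Real.mul_self_sqrt F.card.cast_nonneg]

lemma card_mul_one_sub_le_ncard_edgeBoundary (hd : d ≠ 0) (S : Fin d → Γ) (F : Finset Γ) {c : ℝ}
    (hc : ∀ f : Γ →₀ ℝ, l2norm (rwOp S ⇑f) ≤ c * l2norm ⇑f) :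
    (d : ℝ) * F.card * (1 - c) ≤ (edgeBoundary S F).ncard := by
  classical
  have hd' : (0 : ℝ) < d := by positivity
  have hcount := card_mul_le_ncard_edgeBoundary_add S F
  have hop := sum_rwOp_indicator_le S F hc
  simp only [rwOp] at hop
  rw [← Finset.sum_div, div_le_iff₀ hd'] at hop
  linarith

/-- For a Cayley graph `G = Cay(Γ, S)` of an infinite finitely generated group,
`ι_E(G) ≥ d (1 - ρ(G))`. -/
theorem iotaE_ge (Γ : Type) [Group Γ] [Infinite Γ] (d : ℕ) (S : Fin d → Γ)
    (hgen : Subgroup.closure (Set.range S) = ⊤) :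
    (d : ℝ) * (1 - specRad S) ≤ iotaE S := by
  have hne : {r | ∃ F : Finset Γ, F.Nonempty ∧
      r = ((edgeBoundary S F).ncard : ℝ) / (F.card : ℝ)}.Nonempty :=
    ⟨_, {1}, Finset.singleton_nonempty 1, rfl⟩
  refine le_csInf hne ?_
  rintro r ⟨F, hF, rfl⟩
  rcases eq_or_ne d 0 with rfl | hd
  · simpa using div_nonneg (Nat.cast_nonneg _) (Nat.cast_nonneg _)
  have hd' : (0 : ℝ) < d := by positivity
  have hF' : (0 : ℝ) < F.card := by exact_mod_cast hF.card_pos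
  have hmem : 1 - (edgeBoundary S F).ncard / ((d : ℝ) * F.card) ≤ specRad S := by
    refine le_csInf ⟨1, zero_le_one, fun f => ?_⟩ ?_
    · simpa using l2norm_rwOp_le S (summable_sq_finsupp f)
    · rintro c ⟨-, hc⟩
      have h := card_mul_one_sub_le_ncard_edgeBoundary hd S F hc
      rw [sub_le_comm, le_div_iff₀ (by positivity)]
      linarith
  rw [sub_le_comm, le_div_iff₀ (by positivity)] at hmem
  rw [le_div_iff₀ hF']
  linarith

end
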